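/- arXiv:2109.08111 — 5 statements merged into one kernel-verified Lean document; each statement's English description precedes it below -/
import Mathlib

section
/- Let S : ℝⁿ → ℝ be differentiable, f : ℝⁿ → ℝⁿ, g : ℝⁿ → ℝ^{n×m}, ℓ : ℝⁿ → ℝ^r, w : ℝⁿ → ℝ^{r×m}, and D : ℝⁿ → ℝ^{m×m} with D(x) skew-symmetric for every x. Assume ⟨∇S(x), f(x)⟩ = −‖ℓ(x)‖² for all x ∈ ℝⁿ. Define, for x ∈ ℝⁿ and u ∈ ℝᵐ, the output y(x,u) := g(x)ᵀ∇S(x) + 2 w(x)ᵀℓ(x) + (w(x)ᵀw(x) + D(x))u. Then for all x ∈ ℝⁿ and u ∈ ℝᵐ one has ⟨∇S(x), f(x) + g(x)u⟩ = −‖ℓ(x) + w(x)u‖² + ⟨y(x,u), u⟩, and in particular ⟨∇S(x), f(x) + g(x)u⟩ ≤ ⟨y(x,u), u⟩. -/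
open RealInnerProductSpace Matrix

namespace Matrix

/-- The transpose of a real matrix is its adjoint for the Euclidean inner product. -/
theorem inner_toEuclideanLin_transpose {p q : ℕ} (A : Matrix (Fin p) (Fin q) ℝ)
    (a : EuclideanSpace ℝ (Fin p)) (b : EuclideanSpace ℝ (Fin q)) :
    ⟪toEuclideanLin Aᵀ a, b⟫ = ⟪a, toEuclideanLin A b⟫ := by
  rw [← conjTranspose_eq_transpose_of_trivial, toEuclideanLin_conjTranspose_eq_adjoint,
    LinearMap.adjoint_inner_left]

/-- The quadratic form of a real skew-symmetric matrix vanishes. -/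
theorem inner_toEuclideanLin_self_of_transpose_eq_neg {p : ℕ} {A : Matrix (Fin p) (Fin p) ℝ}
    (hA : Aᵀ = -A) (a : EuclideanSpace ℝ (Fin p)) :
    ⟪toEuclideanLin A a, a⟫ = 0 := by
  have h := inner_toEuclideanLin_transpose A a a
  rw [hA, map_neg, LinearMap.neg_apply, inner_neg_left, real_inner_comm] at h
  rw [real_inner_comm]
  linarith

/-- The quadratic form of the Gram matrix `AᵀA` is `‖A a‖²`. -/
theorem inner_toEuclideanLin_transpose_mul_self {p q : ℕ} (A : Matrix (Fin p) (Fin q) ℝ)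
    (a : EuclideanSpace ℝ (Fin q)) :
    ⟪toEuclideanLin (Aᵀ * A) a, a⟫ = ‖toEuclideanLin A a‖ ^ 2 := by
  have h : toEuclideanLin (Aᵀ * A) a = toEuclideanLin Aᵀ (toEuclideanLin A a) := by
    simp [toLpLin_apply, mulVec_mulVec]
  rw [h, inner_toEuclideanLin_transpose, real_inner_self_eq_norm_sq]

end Matrix

/-- Cyclo-passivity identity: if `⟨∇S(x), f(x)⟩ = −‖ℓ(x)‖²`, then with the output
`y(x,u) = g(x)ᵀ∇S(x) + 2w(x)ᵀℓ(x) + (w(x)ᵀw(x) + D(x))u` (with `D(x)` skew-symmetric),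
one has `⟨∇S(x), f(x) + g(x)u⟩ = −‖ℓ(x) + w(x)u‖² + ⟨y(x,u), u⟩ ≤ ⟨y(x,u), u⟩`. -/
theorem stmt_0 {n m r : ℕ}
    (S : EuclideanSpace ℝ (Fin n) → ℝ) (hS : Differentiable ℝ S)
    (f : EuclideanSpace ℝ (Fin n) → EuclideanSpace ℝ (Fin n))
    (g : EuclideanSpace ℝ (Fin n) → Matrix (Fin n) (Fin m) ℝ)
    (ℓ : EuclideanSpace ℝ (Fin n) → EuclideanSpace ℝ (Fin r))
    (w : EuclideanSpace ℝ (Fin n) → Matrix (Fin r) (Fin m) ℝ)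
    (D : EuclideanSpace ℝ (Fin n) → Matrix (Fin m) (Fin m) ℝ)
    (hD : ∀ x, (D x)ᵀ = -(D x))
    (hpas : ∀ x, ⟪gradient S x, f x⟫ = -‖ℓ x‖ ^ 2)
    (y : EuclideanSpace ℝ (Fin n) → EuclideanSpace ℝ (Fin m) → EuclideanSpace ℝ (Fin m))
    (hy : ∀ x u, y x u = Matrix.toEuclideanLin (g x)ᵀ (gradient S x)
        + (2 : ℝ) • Matrix.toEuclideanLin (w x)ᵀ (ℓ x)
        + Matrix.toEuclideanLin ((w x)ᵀ * w x + D x) u) :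
    ∀ (x : EuclideanSpace ℝ (Fin n)) (u : EuclideanSpace ℝ (Fin m)),
      ⟪gradient S x, f x + Matrix.toEuclideanLin (g x) u⟫
          = -‖ℓ x + Matrix.toEuclideanLin (w x) u‖ ^ 2 + ⟪y x u, u⟫
      ∧ ⟪gradient S x, f x + Matrix.toEuclideanLin (g x) u⟫ ≤ ⟪y x u, u⟫ := by
  intro x u
  have key : ⟪gradient S x, f x + Matrix.toEuclideanLin (g x) u⟫
      = -‖ℓ x + Matrix.toEuclideanLin (w x) u‖ ^ 2 + ⟪y x u, u⟫ := by
    rw [hy, map_add, LinearMap.add_apply, inner_add_right, hpas, inner_add_left, inner_add_left,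
      inner_add_left, real_inner_smul_left, inner_toEuclideanLin_transpose,
      inner_toEuclideanLin_transpose, inner_toEuclideanLin_transpose_mul_self,
      inner_toEuclideanLin_self_of_transpose_eq_neg (hD x), norm_add_sq_real]
    ring
  exact ⟨key, by rw [key]; linarith [sq_nonneg ‖ℓ x + Matrix.toEuclideanLin (w x) u‖]⟩
end

section
/- Let S : ℝⁿ → ℝ and γ : ℝⁿ → ℝᵐ be differentiable, f : ℝⁿ → ℝⁿ, g : ℝⁿ → ℝ^{n×m}, ℓ : ℝⁿ → ℝ^r, w : ℝⁿ → ℝ^{r×m}, D : ℝⁿ → ℝ^{m×m} with D(x) skew-symmetric, and assume ⟨∇S(x), f(x)⟩ = −‖ℓ(x)‖² for all x. Define y(x,u) := g(x)ᵀ∇S(x) + 2w(x)ᵀℓ(x) + (w(x)ᵀw(x) + D(x))u. Fix γ_* ∈ ℝᵐ, κ ∈ ℝᵐ, positive constants α_i, β_i, k_{p_i}, and define Φ : ℝᵐ → ℝ by Φ(γ) := Σ_{i=1}^{m} (α_i/β_i) · ln(cosh(β_i (γ_i − γ_{*,i}))), and S_d : ℝⁿ → ℝ by S_d(x) := S(x)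 + Φ(γ(x)) + ⟨κ, γ(x)⟩. Let x : ℝ → ℝⁿ be differentiable with ẋ(t) = f(x(t)) + g(x(t))u(t), suppose (d/dt) γ(x(t)) = y(x(t),u(t)) for all t, and let the control be u(t) = −∇Φ(γ(x(t))) − κ − Σ_{i=1}^{m} e_i k_{p_i} tanh(y_i(x(t),u(t))). Then for all t, (d/dt) S_d(x(t)) ≤ −Σ_{i=1}^{m} k_{p_i} · y_i(x(t),u(t)) · tanh(y_i(x(t),u(t))) ≤ 0. -/
open RealInnerProductSpace Matrix

theorem Real.mul_tanh_nonneg (x : ℝ) : 0 ≤ x * Real.tanh x := by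
  rw [Real.tanh_eq_sinh_div_cosh, ← mul_div_assoc]
  refine div_nonneg ?_ (Real.cosh_pos x).le
  rcases le_total 0 x with h | h
  · exact mul_nonneg h (Real.sinh_nonneg_iff.2 h)
  · exact mul_nonneg_of_nonpos_of_nonpos h (Real.sinh_nonpos_iff.2 h)

theorem Matrix.inner_toEuclideanLin_transpose_s3 {a b : Type*} [Fintype a] [Fintype b]
    [DecidableEq a] [DecidableEq b] (A : Matrix a b ℝ)
    (v : EuclideanSpace ℝ a) (z : EuclideanSpace ℝ b) :
    ⟪Matrix.toEuclideanLin Aᵀ v, z⟫ = ⟪v, Matrix.toEuclideanLin A z⟫ := by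
  rw [← Matrix.conjTranspose_eq_transpose_of_trivial,
    Matrix.toEuclideanLin_conjTranspose_eq_adjoint, LinearMap.adjoint_inner_left]

theorem Matrix.inner_toEuclideanLin_self_of_transpose_eq_neg_s3 {a : Type*} [Fintype a]
    [DecidableEq a] {A : Matrix a a ℝ} (hA : Aᵀ = -A) (v : EuclideanSpace ℝ a) :
    ⟪Matrix.toEuclideanLin A v, v⟫ = 0 := by
  have h := Matrix.inner_toEuclideanLin_transpose_s3 A v v
  rw [hA, map_neg, LinearMap.neg_apply, inner_neg_left,
    real_inner_comm (Matrix.toEuclideanLin A v) v] at h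
  linarith

theorem Matrix.inner_toEuclideanLin_transpose_mul_self_s3 {a b : Type*} [Fintype a] [Fintype b]
    [DecidableEq a] [DecidableEq b] (A : Matrix a b ℝ) (v : EuclideanSpace ℝ b) :
    ⟪Matrix.toEuclideanLin (Aᵀ * A) v, v⟫ = ‖Matrix.toEuclideanLin A v‖ ^ 2 := by
  have h : Matrix.toEuclideanLin (Aᵀ * A) v
      = Matrix.toEuclideanLin Aᵀ (Matrix.toEuclideanLin A v) := by
    simp [Matrix.toLpLin_apply, Matrix.mulVec_mulVec]
  rw [h, Matrix.inner_toEuclideanLin_transpose_s3, real_inner_self_eq_norm_sq]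

theorem Differentiable.hasDerivAt_comp_inner_gradient {E : Type*} [NormedAddCommGroup E]
    [InnerProductSpace ℝ E] [CompleteSpace E] {F : E → ℝ} (hF : Differentiable ℝ F)
    {c : ℝ → E} {c' : E} {t : ℝ} (hc : HasDerivAt c c' t) :
    HasDerivAt (fun s => F (c s)) ⟪gradient F (c t), c'⟫ t := by
  have h := (hF (c t)).hasGradientAt.hasFDerivAt.comp_hasDerivAt t hc
  simpa [Function.comp_def] using h

/-- Dissipation inequality for the saturated energy-shaping-plus-damping controller:
along closed-loop trajectories, the shaped storage function
`S_d(x) = S(x) + Φ(γ(x)) + ⟨κ, γ(x)⟩` satisfies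
`(d/dt) S_d(x(t)) ≤ −Σᵢ k_{pᵢ} yᵢ tanh(yᵢ) ≤ 0`. -/
theorem stmt_3 {n m r : ℕ}
    (S : EuclideanSpace ℝ (Fin n) → ℝ) (hS : Differentiable ℝ S)
    (γ : EuclideanSpace ℝ (Fin n) → EuclideanSpace ℝ (Fin m)) (hγ : Differentiable ℝ γ)
    (f : EuclideanSpace ℝ (Fin n) → EuclideanSpace ℝ (Fin n))
    (g : EuclideanSpace ℝ (Fin n) → Matrix (Fin n) (Fin m) ℝ)
    (ℓ : EuclideanSpace ℝ (Fin n) → EuclideanSpace ℝ (Fin r))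
    (w : EuclideanSpace ℝ (Fin n) → Matrix (Fin r) (Fin m) ℝ)
    (D : EuclideanSpace ℝ (Fin n) → Matrix (Fin m) (Fin m) ℝ)
    (hD : ∀ x, (D x)ᵀ = -(D x))
    (hpas : ∀ x, ⟪gradient S x, f x⟫ = -‖ℓ x‖ ^ 2)
    (y : EuclideanSpace ℝ (Fin n) → EuclideanSpace ℝ (Fin m) → EuclideanSpace ℝ (Fin m))
    (hy : ∀ x u, y x u = Matrix.toEuclideanLin (g x)ᵀ (gradient S x)
        + (2 : ℝ) • Matrix.toEuclideanLin (w x)ᵀ (ℓ x)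
        + Matrix.toEuclideanLin ((w x)ᵀ * w x + D x) u)
    (γs κ : EuclideanSpace ℝ (Fin m))
    (α β kp : Fin m → ℝ) (hα : ∀ i, 0 < α i) (hβ : ∀ i, 0 < β i) (hkp : ∀ i, 0 < kp i)
    (Φ : EuclideanSpace ℝ (Fin m) → ℝ)
    (hΦ : ∀ z, Φ z = ∑ i, α i / β i * Real.log (Real.cosh (β i * (z i - γs i))))
    (Sd : EuclideanSpace ℝ (Fin n) → ℝ)
    (hSd : ∀ x, Sd x = S x + Φ (γ x) + ⟪κ, γ x⟫)
    (x : ℝ → EuclideanSpace ℝ (Fin n)) (hx : Differentiable ℝ x)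
    (u : ℝ → EuclideanSpace ℝ (Fin m))
    (hdyn : ∀ t, deriv x t = f (x t) + Matrix.toEuclideanLin (g (x t)) (u t))
    (hγdyn : ∀ t, deriv (fun s => γ (x s)) t = y (x t) (u t))
    (hu : ∀ t, u t = -gradient Φ (γ (x t)) - κ
        - ∑ i, (kp i * Real.tanh (y (x t) (u t) i)) • EuclideanSpace.single i (1 : ℝ)) :
    ∀ t, deriv (fun s => Sd (x s)) t
          ≤ -∑ i, kp i * (y (x t) (u t) i * Real.tanh (y (x t) (u t) i))
      ∧ -∑ i, kp i * (y (x t) (u t) i * Real.tanh (y (x t) (u t) i)) ≤ 0 := by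
  intro t
  refine ⟨?_, neg_nonpos.2 (Finset.sum_nonneg fun i _ =>
    mul_nonneg (hkp i).le (Real.mul_tanh_nonneg _))⟩
  have hΦd : Differentiable ℝ Φ := by
    rw [funext hΦ]
    refine Differentiable.fun_sum fun i _ => Differentiable.const_mul ?_ _
    refine Differentiable.log ?_ fun z => (Real.cosh_pos _).ne'
    exact Real.differentiable_cosh.comp (by fun_prop)
  have hxd := (hx t).hasDerivAt
  have hγd := (hγ.comp hx t).hasDerivAt
  have hγt : HasDerivAt (fun s => γ (x s)) (y (x t) (u t)) t := hγdyn t ▸ hγd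
  have hSdd : HasDerivAt (fun s => Sd (x s))
      (⟪gradient S (x t), deriv x t⟫ + ⟪gradient Φ (γ (x t)), y (x t) (u t)⟫
        + ⟪κ, y (x t) (u t)⟫) t := by
    simp only [hSd]
    refine ((hS.hasDerivAt_comp_inner_gradient hxd).add
      (hΦd.hasDerivAt_comp_inner_gradient hγt)).add ?_
    simpa using (hasDerivAt_const t κ).inner ℝ hγt
  rw [hSdd.deriv, hdyn, inner_add_right, hpas, ← Matrix.inner_toEuclideanLin_transpose_s3]
  have hpow : ⟪y (x t) (u t), u t⟫ = ⟪Matrix.toEuclideanLin (g (x t))ᵀ (gradient S (x t)), u t⟫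
      + 2 * ⟪ℓ (x t), Matrix.toEuclideanLin (w (x t)) (u t)⟫
      + ‖Matrix.toEuclideanLin (w (x t)) (u t)‖ ^ 2 := by
    rw [hy, inner_add_left, inner_add_left, real_inner_smul_left,
      Matrix.inner_toEuclideanLin_transpose_s3 (w (x t)), map_add, LinearMap.add_apply,
      inner_add_left, Matrix.inner_toEuclideanLin_transpose_mul_self_s3,
      Matrix.inner_toEuclideanLin_self_of_transpose_eq_neg_s3 (hD _), add_zero]
  have hctrl : ⟪y (x t) (u t), u t⟫ = -⟪gradient Φ (γ (x t)), y (x t) (u t)⟫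
      - ⟪κ, y (x t) (u t)⟫
      - ∑ i, kp i * (y (x t) (u t) i * Real.tanh (y (x t) (u t) i)) := by
    generalize hY : y (x t) (u t) = Y
    rw [hu t, hY, inner_sub_right, inner_sub_right, inner_neg_right, inner_sum,
      real_inner_comm Y, real_inner_comm Y]
    congr 1
    refine Finset.sum_congr rfl fun i _ => ?_
    rw [real_inner_smul_right, EuclideanSpace.inner_single_right]
    simp only [conj_trivial]
    ring
  have hsq := norm_add_sq_real (ℓ (x t)) (Matrix.toEuclideanLin (w (x t)) (u t))
  have hnn := sq_nonneg ‖ℓ (x t) + Matrix.toEuclideanLin (w (x t)) (u t)‖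
  linarith
end

section
/- Let S : ℝⁿ → ℝ and γ : ℝⁿ → ℝᵐ be differentiable, f : ℝⁿ → ℝⁿ, g : ℝⁿ → ℝ^{n×m}, ℓ : ℝⁿ → ℝ^r, w : ℝⁿ → ℝ^{r×m}, D : ℝⁿ → ℝ^{m×m} with D(x) skew-symmetric, and assume ⟨∇S(x), f(x)⟩ = −‖ℓ(x)‖² for all x. Define y(x,u) := g(x)ᵀ∇S(x) + 2w(x)ᵀℓ(x) + (w(x)ᵀw(x) + D(x))u. Fix γ_* ∈ ℝᵐ, κ ∈ ℝᵐ, positive constants α_{c_i}, β_{c_i}, and symmetric positive definite matrices R_c, K_c ∈ ℝ^{m×m}. Define Φ_c : ℝᵐ → ℝ by Φ_c(z) := Σ_{i=1}^{m} (α_{c_i}/β_{c_i}) · ln(cosh(β_{c_i} z_i)). Let x : ℝ → ℝⁿ and x_c : ℝ → ℝᵐ be differentiable, set z_c(t) := γ(x(t)) − γ_* + x_c(t), and suppose ẋ(t) = f(x(t)) + g(x(t))u(t) with u(t) = −κ − ∇Φ_c(z_c(t)), ẋ_c(t) = −R_c (∇Φ_c(z_c(t)) + K_c x_c(t)), and (d/dt)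 γ(x(t)) = y(x(t),u(t)). Define S_{d_c}(t) := S(x(t)) + Φ_c(z_c(t)) + ⟨κ, γ(x(t))⟩ + (1/2)⟨x_c(t), K_c x_c(t)⟩. Then (d/dt) S_{d_c}(t) = −‖ℓ(x(t)) + w(x(t))u(t)‖² − ⟨ẋ_c(t), R_c^{-1} ẋ_c(t)⟩ ≤ 0 for all t. -/
open RealInnerProductSpace Matrix

theorem inner_toEuclideanLin_transpose_left {p q : ℕ} (A : Matrix (Fin p) (Fin q) ℝ)
    (a : EuclideanSpace ℝ (Fin p)) (b : EuclideanSpace ℝ (Fin q)) :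
    ⟪Matrix.toEuclideanLin Aᵀ a, b⟫ = ⟪a, Matrix.toEuclideanLin A b⟫ := by
  rw [← Matrix.conjTranspose_eq_transpose_of_trivial,
    Matrix.toEuclideanLin_conjTranspose_eq_adjoint, LinearMap.adjoint_inner_left]

theorem inner_toEuclideanLin_self_of_skew {m : ℕ} {A : Matrix (Fin m) (Fin m) ℝ}
    (hA : Aᵀ = -A) (a : EuclideanSpace ℝ (Fin m)) :
    ⟪Matrix.toEuclideanLin A a, a⟫ = 0 := by
  have h := inner_toEuclideanLin_transpose_left A a a
  rw [hA, map_neg, LinearMap.neg_apply, inner_neg_left, real_inner_comm] at h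
  rw [real_inner_comm]
  linarith

theorem toEuclideanLin_mul_apply {p q r : ℕ} (A : Matrix (Fin p) (Fin q) ℝ)
    (B : Matrix (Fin q) (Fin r) ℝ) (a : EuclideanSpace ℝ (Fin r)) :
    Matrix.toEuclideanLin (A * B) a = Matrix.toEuclideanLin A (Matrix.toEuclideanLin B a) := by
  simp [Matrix.toLpLin_apply]

theorem inner_toEuclideanLin_self_nonneg {m : ℕ} {A : Matrix (Fin m) (Fin m) ℝ}
    (hA : A.PosSemidef) (a : EuclideanSpace ℝ (Fin m)) :
    0 ≤ ⟪a, Matrix.toEuclideanLin A a⟫ := by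
  have h := hA.dotProduct_mulVec_nonneg a.ofLp
  simpa [EuclideanSpace.inner_eq_star_dotProduct, Matrix.toLpLin_apply,
    dotProduct_comm] using h

theorem hasDerivAt_comp_of_differentiableAt {E : Type*} [NormedAddCommGroup E]
    [InnerProductSpace ℝ E] [CompleteSpace E] {F : E → ℝ} {c : ℝ → E} {c' : E} {t : ℝ}
    (hF : DifferentiableAt ℝ F (c t)) (hc : HasDerivAt c c' t) :
    HasDerivAt (fun s => F (c s)) ⟪gradient F (c t), c'⟫ t := by
  rw [inner_gradient_left]
  exact hF.hasFDerivAt.comp_hasDerivAt t hc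

/-- Dissipation identity for the dynamic-extension controller: along closed-loop
trajectories with controller state `x_c`, the storage function
`S_{d_c} = S(x) + Φ_c(z_c) + ⟨κ, γ(x)⟩ + (1/2)⟨x_c, K_c x_c⟩` satisfies
`(d/dt) S_{d_c} = −‖ℓ + wu‖² − ⟨ẋ_c, R_c⁻¹ ẋ_c⟩ ≤ 0`. -/
theorem stmt_6 {n m r : ℕ}
    (S : EuclideanSpace ℝ (Fin n) → ℝ) (hS : Differentiable ℝ S)
    (γ : EuclideanSpace ℝ (Fin n) → EuclideanSpace ℝ (Fin m)) (hγ : Differentiable ℝ γ)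
    (f : EuclideanSpace ℝ (Fin n) → EuclideanSpace ℝ (Fin n))
    (g : EuclideanSpace ℝ (Fin n) → Matrix (Fin n) (Fin m) ℝ)
    (ℓ : EuclideanSpace ℝ (Fin n) → EuclideanSpace ℝ (Fin r))
    (w : EuclideanSpace ℝ (Fin n) → Matrix (Fin r) (Fin m) ℝ)
    (D : EuclideanSpace ℝ (Fin n) → Matrix (Fin m) (Fin m) ℝ)
    (hD : ∀ x, (D x)ᵀ = -(D x))
    (hpas : ∀ x, ⟪gradient S x, f x⟫ = -‖ℓ x‖ ^ 2)
    (y : EuclideanSpace ℝ (Fin n) → EuclideanSpace ℝ (Fin m) → EuclideanSpace ℝ (Fin m))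
    (hy : ∀ x u, y x u = Matrix.toEuclideanLin (g x)ᵀ (gradient S x)
        + (2 : ℝ) • Matrix.toEuclideanLin (w x)ᵀ (ℓ x)
        + Matrix.toEuclideanLin ((w x)ᵀ * w x + D x) u)
    (γs κ : EuclideanSpace ℝ (Fin m))
    (αc βc : Fin m → ℝ) (hαc : ∀ i, 0 < αc i) (hβc : ∀ i, 0 < βc i)
    (Rc Kc : Matrix (Fin m) (Fin m) ℝ) (hRc : Rc.PosDef) (hKc : Kc.PosDef)
    (Φc : EuclideanSpace ℝ (Fin m) → ℝ)
    (hΦc : ∀ z, Φc z = ∑ i, αc i / βc i * Real.log (Real.cosh (βc i * z i)))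
    (x : ℝ → EuclideanSpace ℝ (Fin n)) (hx : Differentiable ℝ x)
    (xc : ℝ → EuclideanSpace ℝ (Fin m)) (hxc : Differentiable ℝ xc)
    (zc : ℝ → EuclideanSpace ℝ (Fin m))
    (hzc : ∀ t, zc t = γ (x t) - γs + xc t)
    (u : ℝ → EuclideanSpace ℝ (Fin m))
    (hu : ∀ t, u t = -κ - gradient Φc (zc t))
    (hdyn : ∀ t, deriv x t = f (x t) + Matrix.toEuclideanLin (g (x t)) (u t))
    (hxcdyn : ∀ t, deriv xc t
        = -(Matrix.toEuclideanLin Rc)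
            (gradient Φc (zc t) + Matrix.toEuclideanLin Kc (xc t)))
    (hγdyn : ∀ t, deriv (fun s => γ (x s)) t = y (x t) (u t))
    (Sdc : ℝ → ℝ)
    (hSdc : ∀ t, Sdc t = S (x t) + Φc (zc t) + ⟪κ, γ (x t)⟫
        + 1 / 2 * ⟪xc t, Matrix.toEuclideanLin Kc (xc t)⟫) :
    ∀ t, deriv Sdc t
          = -‖ℓ (x t) + Matrix.toEuclideanLin (w (x t)) (u t)‖ ^ 2
            - ⟪deriv xc t, Matrix.toEuclideanLin Rc⁻¹ (deriv xc t)⟫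
      ∧ deriv Sdc t ≤ 0 := by
  have hΦ : Differentiable ℝ Φc := by
    rw [funext hΦc]
    have hcosh : ∀ (z : EuclideanSpace ℝ (Fin m)) i, Real.cosh (βc i * z i) ≠ 0 :=
      fun z i => (Real.cosh_pos _).ne'
    fun_prop (disch := exact fun z => hcosh z _)
  intro t
  have hx' := (hx t).hasDerivAt
  have hxc' := (hxc t).hasDerivAt
  have hγ' : HasDerivAt (fun s => γ (x s)) (y (x t) (u t)) t := by
    rw [← hγdyn t]
    exact ((hγ (x t)).comp t (hx t)).hasDerivAt
  have hzc' : HasDerivAt zc (y (x t) (u t) + deriv xc t) t := by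
    rw [funext hzc]
    exact (hγ'.sub_const γs).add hxc'
  have hKxc : HasDerivAt (fun s => Matrix.toEuclideanLin Kc (xc s))
      (Matrix.toEuclideanLin Kc (deriv xc t)) t :=
    (LinearMap.toContinuousLinearMap (Matrix.toEuclideanLin Kc)).hasFDerivAt.comp_hasDerivAt t hxc'
  have hKsymm : ⟪xc t, Matrix.toEuclideanLin Kc (deriv xc t)⟫
      = ⟪deriv xc t, Matrix.toEuclideanLin Kc (xc t)⟫ := by
    have hKt : Kcᵀ = Kc := by
      rw [← Matrix.conjTranspose_eq_transpose_of_trivial]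
      exact hKc.isHermitian
    rw [← inner_toEuclideanLin_transpose_left, hKt, real_inner_comm]
  have hder : HasDerivAt Sdc (⟪gradient S (x t), deriv x t⟫
      + ⟪gradient Φc (zc t), y (x t) (u t) + deriv xc t⟫ + ⟪κ, y (x t) (u t)⟫
      + ⟪deriv xc t, Matrix.toEuclideanLin Kc (xc t)⟫) t := by
    rw [funext hSdc]
    have hκ : HasDerivAt (fun s => ⟪κ, γ (x s)⟫) ⟪κ, y (x t) (u t)⟫ t := by
      simpa using (hasDerivAt_const t κ).inner ℝ hγ'
    have hquad : HasDerivAt (fun s => 1 / 2 * ⟪xc s, Matrix.toEuclideanLin Kc (xc s)⟫)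
        ⟪deriv xc t, Matrix.toEuclideanLin Kc (xc t)⟫ t := by
      refine ((hxc'.inner ℝ hKxc).const_mul (1 / 2)).congr_deriv ?_
      rw [hKsymm]
      ring
    exact (((hasDerivAt_comp_of_differentiableAt (hS _) hx').add
      (hasDerivAt_comp_of_differentiableAt (hΦ _) hzc')).add hκ).add hquad
  have hplant : ⟪gradient S (x t), deriv x t⟫ - ⟪u t, y (x t) (u t)⟫
      = -‖ℓ (x t) + Matrix.toEuclideanLin (w (x t)) (u t)‖ ^ 2 := by
    rw [hdyn, hy, inner_add_right, hpas, real_inner_comm _ (u t), inner_add_left, inner_add_left,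
      inner_smul_left, map_add, LinearMap.add_apply, inner_add_left,
      inner_toEuclideanLin_self_of_skew (hD _), toEuclideanLin_mul_apply,
      inner_toEuclideanLin_transpose_left, inner_toEuclideanLin_transpose_left,
      inner_toEuclideanLin_transpose_left, norm_add_sq_real, real_inner_self_eq_norm_sq]
    simp only [conj_trivial]
    ring
  have hctrl : gradient Φc (zc t) + Matrix.toEuclideanLin Kc (xc t)
      = -Matrix.toEuclideanLin Rc⁻¹ (deriv xc t) := by
    have hdet : IsUnit Rc.det := hRc.det_pos.ne'.isUnit
    rw [hxcdyn, map_neg, neg_neg, ← toEuclideanLin_mul_apply, Matrix.nonsing_inv_mul _ hdet]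
    simp [Matrix.toLpLin_apply]
  have hκu : κ = -u t - gradient Φc (zc t) := by
    rw [hu]
    abel
  have hmain : deriv Sdc t
      = -‖ℓ (x t) + Matrix.toEuclideanLin (w (x t)) (u t)‖ ^ 2
        - ⟪deriv xc t, Matrix.toEuclideanLin Rc⁻¹ (deriv xc t)⟫ := by
    have hinner := congrArg (fun v => ⟪deriv xc t, v⟫) hctrl
    simp only [inner_add_right, inner_neg_right] at hinner
    rw [hder.deriv, ← hplant, hκu, inner_add_right, inner_sub_left, inner_neg_left,
      real_inner_comm (deriv xc t) (gradient Φc (zc t))]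
    linarith
  refine ⟨hmain, ?_⟩
  rw [hmain]
  have hR := inner_toEuclideanLin_self_nonneg hRc.inv.posSemidef (deriv xc t)
  have hn := sq_nonneg ‖ℓ (x t) + Matrix.toEuclideanLin (w (x t)) (u t)‖
  linarith
end

section
/- Let M : ℝⁿ → ℝ^{n×n} be continuously differentiable with M(q) symmetric positive definite for every q, V : ℝⁿ → ℝ continuously differentiable, 𝒟 : ℝⁿ × ℝⁿ → ℝ^{n×n} with 𝒟(q,p) positive semidefinite, R_c, K_c ∈ ℝ^{n×n} symmetric positive definite, q_* ∈ ℝⁿ and positive constants α_{c_i}, β_{c_i}. Define H(q,p) := (1/2)⟨p, M(q)^{-1}p⟩ + V(q), Φ_c(q, x_c) := Σ_{i=1}^{n} (α_{c_i}/β_{c_i}) · ln(cosh(β_{c_i}(q_i − q_{*,i} + x_{c,i}))), and H_d(q,p,x_c) := Φ_c(q,x_c) + (1/2)⟨p, M(q)^{-1}p⟩ + (1/2)⟨x_c, K_c x_c⟩. Let q, p, x_c : ℝ → ℝⁿ be differentiable curves satisfying q̇ = M(q)^{-1}p, ṗ = −∇_q H(q,p) − 𝒟(q,p) M(q)^{-1}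 p + u, ẋ_c = −R_c(K_c x_c + ∇_{x_c}Φ_c(q,x_c)), with control u(t) = ∇V(q(t)) − ∇_q Φ_c(q(t), x_c(t)). Then for all t, (d/dt) H_d(q(t),p(t),x_c(t)) = −⟨q̇(t), 𝒟(q(t),p(t)) q̇(t)⟩ − ⟨∇_{x_c}H_d(q(t),p(t),x_c(t)), R_c ∇_{x_c}H_d(q(t),p(t),x_c(t))⟩ ≤ 0. -/
open RealInnerProductSpace Matrix

/-- A real function of the form `s ↦ f (γ s)` has derivative `⟪∇ f, γ'⟫`. -/
theorem DifferentiableAt.hasDerivAt_comp_gradient {E : Type*} [NormedAddCommGroup E]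
    [InnerProductSpace ℝ E] [CompleteSpace E] {f : E → ℝ} {γ : ℝ → E} {γ' : E} {t : ℝ}
    (hf : DifferentiableAt ℝ f (γ t)) (hγ : HasDerivAt γ γ' t) :
    HasDerivAt (fun s => f (γ s)) ⟪gradient f (γ t), γ'⟫ t := by
  have h := hf.hasGradientAt.hasFDerivAt.comp_hasDerivAt t hγ
  simpa [Function.comp_def] using h

theorem gradient_comp_add_right {E : Type*} [NormedAddCommGroup E]
    [InnerProductSpace ℝ E] [CompleteSpace E] (f : E → ℝ) (a x : E) :
    gradient (fun y => f (y + a)) x = gradient f (x + a) := by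
  simp only [gradient, fderiv_comp_add_right]

theorem gradient_fun_add {E : Type*} [NormedAddCommGroup E]
    [InnerProductSpace ℝ E] [CompleteSpace E] {f g : E → ℝ} {x : E}
    (hf : DifferentiableAt ℝ f x) (hg : DifferentiableAt ℝ g x) :
    gradient (fun y => f y + g y) x = gradient f x + gradient g x := by
  simp only [gradient, fderiv_fun_add hf hg, map_add]

/-- Gradient of a quadratic form given by a symmetric operator. -/
theorem hasGradientAt_half_inner_self {E : Type*} [NormedAddCommGroup E]
    [InnerProductSpace ℝ E] [CompleteSpace E] {T : E →L[ℝ] E}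
    (hT : (T : E →ₗ[ℝ] E).IsSymmetric) (x : E) :
    HasGradientAt (fun y => 1 / 2 * ⟪y, T y⟫) (T x) x := by
  rw [hasGradientAt_iff_hasFDerivAt]
  have h := ((hasFDerivAt_id (𝕜 := ℝ) x).inner ℝ (T.hasFDerivAt (x := x))).const_mul (1 / 2 : ℝ)
  refine h.congr_fderiv ?_
  ext v
  have h₁ : ⟪T x, v⟫ = ⟪x, T v⟫ := hT x v
  have h₂ : ⟪v, T x⟫ = ⟪T x, v⟫ := real_inner_comm _ _
  simp [h₁, h₂]
  ring

/-- Derivative of the kinetic energy `½⟪p, A(q) p⟫` along a curve. -/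
theorem hasDerivAt_half_inner_apply_self {E F : Type*} [NormedAddCommGroup E]
    [InnerProductSpace ℝ E] [CompleteSpace E] [NormedAddCommGroup F]
    [InnerProductSpace ℝ F] [CompleteSpace F] {A : F → E →L[ℝ] E} {q : ℝ → F} {p : ℝ → E}
    {q' : F} {p' : E} {t : ℝ} (hA : DifferentiableAt ℝ A (q t))
    (hsymm : (A (q t) : E →ₗ[ℝ] E).IsSymmetric)
    (hq : HasDerivAt q q' t) (hp : HasDerivAt p p' t) :
    HasDerivAt (fun s => 1 / 2 * ⟪p s, A (q s) (p s)⟫)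
      (⟪gradient (fun y => 1 / 2 * ⟪p t, A y (p t)⟫) (q t), q'⟫ + ⟪A (q t) (p t), p'⟫) t := by
  have hAq : HasDerivAt (fun s => A (q s)) (fderiv ℝ A (q t) q') t :=
    hA.hasFDerivAt.comp_hasDerivAt t hq
  have h := (hp.inner ℝ (hAq.clm_apply hp)).const_mul (1 / 2 : ℝ)
  have hfix := ((hasDerivAt_const t (p t)).inner ℝ
    (hAq.clm_apply (hasDerivAt_const t (p t)))).const_mul (1 / 2 : ℝ)
  have hgrad := DifferentiableAt.hasDerivAt_comp_gradient
    (f := fun y => 1 / 2 * ⟪p t, A y (p t)⟫) (γ := q)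
    (((differentiableAt_const (p t)).inner ℝ
      (hA.clm_apply (differentiableAt_const (p t)))).const_mul (1 / 2 : ℝ)) hq
  rw [hgrad.unique hfix]
  refine h.congr_deriv ?_
  have h₁ : ⟪A (q t) (p t), p'⟫ = ⟪p t, A (q t) p'⟫ := hsymm _ _
  have h₂ : ⟪p', A (q t) (p t)⟫ = ⟪A (q t) (p t), p'⟫ := real_inner_comm _ _
  simp only [inner_add_right, map_zero, inner_zero_left, inner_zero_right, h₁, h₂]
  ring

/-- Entrywise differentiability passes to the inverse, viewed as an operator. -/
theorem Matrix.differentiable_toEuclideanCLM_inv {F : Type*} [NormedAddCommGroup F]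
    [NormedSpace ℝ F] {n : ℕ} {M : F → Matrix (Fin n) (Fin n) ℝ}
    (hM : ∀ i j, Differentiable ℝ fun x => M x i j) (hunit : ∀ x, IsUnit (M x)) :
    Differentiable ℝ fun x => toEuclideanCLM (n := Fin n) (𝕜 := ℝ) (M x)⁻¹ := by
  have hsum : (fun x => toEuclideanCLM (n := Fin n) (𝕜 := ℝ) (M x)) = fun x =>
      ∑ i, ∑ j, M x i j • toEuclideanCLM (n := Fin n) (𝕜 := ℝ) (Matrix.single i j 1) := by
    funext x
    conv_lhs => rw [Matrix.matrix_eq_sum_single (M x)]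
    simp only [map_sum, ← map_smul, Matrix.smul_single, smul_eq_mul, mul_one]
  have hd : Differentiable ℝ fun x => toEuclideanCLM (n := Fin n) (𝕜 := ℝ) (M x) := by
    rw [hsum]
    fun_prop
  have hinv : (fun x => toEuclideanCLM (n := Fin n) (𝕜 := ℝ) (M x)⁻¹) = fun x =>
      Ring.inverse (toEuclideanCLM (n := Fin n) (𝕜 := ℝ) (M x)) := by
    funext x
    rw [Matrix.nonsing_inv_eq_ringInverse]
    obtain ⟨U, hU⟩ := hunit x
    rw [← hU, Ring.inverse_unit]
    exact (Ring.inverse_unit (Units.map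
      (MonoidHomClass.toMonoidHom (toEuclideanCLM (n := Fin n) (𝕜 := ℝ))) U)).symm
  rw [hinv]
  intro x
  exact (differentiableAt_inverse (𝕜 := ℝ)
    ((hunit x).map (toEuclideanCLM (n := Fin n) (𝕜 := ℝ)))).comp x (hd x)

theorem Matrix.PosSemidef.inner_toEuclideanLin_nonneg {n : ℕ} {D : Matrix (Fin n) (Fin n) ℝ}
    (hD : D.PosSemidef) (v : EuclideanSpace ℝ (Fin n)) : 0 ≤ ⟪v, toEuclideanLin D v⟫ := by
  have h := (Matrix.isPositive_toEuclideanLin_iff.2 hD).inner_nonneg_right v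
  simpa using h

theorem Matrix.IsHermitian.isSymmetric_toEuclideanCLM {n : ℕ} {D : Matrix (Fin n) (Fin n) ℝ}
    (hD : D.IsHermitian) :
    (toEuclideanCLM (n := Fin n) (𝕜 := ℝ) D :
      EuclideanSpace ℝ (Fin n) →ₗ[ℝ] EuclideanSpace ℝ (Fin n)).IsSymmetric :=
  Matrix.isSymmetric_toEuclideanLin_iff.2 hD

/-- Dissipation identity for a fully actuated port-Hamiltonian mechanical system under the
saturated gravity-compensating controller with dynamic extension:
`(d/dt) H_d = −⟨q̇, 𝒟 q̇⟩ − ⟨∇_{x_c}H_d, R_c ∇_{x_c}H_d⟩ ≤ 0`. -/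
theorem stmt_12 {n : ℕ}
    (M : EuclideanSpace ℝ (Fin n) → Matrix (Fin n) (Fin n) ℝ)
    (hM : ∀ i j, ContDiff ℝ 1 fun q => M q i j)
    (hMpd : ∀ q, (M q).PosDef)
    (V : EuclideanSpace ℝ (Fin n) → ℝ) (hV : ContDiff ℝ 1 V)
    (𝒟 : EuclideanSpace ℝ (Fin n) → EuclideanSpace ℝ (Fin n) → Matrix (Fin n) (Fin n) ℝ)
    (h𝒟 : ∀ q p, (𝒟 q p).PosSemidef)
    (Rc Kc : Matrix (Fin n) (Fin n) ℝ) (hRc : Rc.PosDef) (hKc : Kc.PosDef)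
    (qs : EuclideanSpace ℝ (Fin n))
    (αc βc : Fin n → ℝ) (hαc : ∀ i, 0 < αc i) (hβc : ∀ i, 0 < βc i)
    (H : EuclideanSpace ℝ (Fin n) → EuclideanSpace ℝ (Fin n) → ℝ)
    (hH : ∀ q p, H q p = 1 / 2 * ⟪p, Matrix.toEuclideanLin (M q)⁻¹ p⟫ + V q)
    (Φc : EuclideanSpace ℝ (Fin n) → EuclideanSpace ℝ (Fin n) → ℝ)
    (hΦc : ∀ q xc, Φc q xc
        = ∑ i, αc i / βc i * Real.log (Real.cosh (βc i * (q i - qs i + xc i))))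
    (Hd : EuclideanSpace ℝ (Fin n) → EuclideanSpace ℝ (Fin n) → EuclideanSpace ℝ (Fin n) → ℝ)
    (hHd : ∀ q p xc, Hd q p xc
        = Φc q xc + 1 / 2 * ⟪p, Matrix.toEuclideanLin (M q)⁻¹ p⟫
          + 1 / 2 * ⟪xc, Matrix.toEuclideanLin Kc xc⟫)
    (q p xc : ℝ → EuclideanSpace ℝ (Fin n))
    (hq : Differentiable ℝ q) (hp : Differentiable ℝ p) (hxc : Differentiable ℝ xc)
    (u : ℝ → EuclideanSpace ℝ (Fin n))
    (hu : ∀ t, u t = gradient V (q t) - gradient (fun q' => Φc q' (xc t)) (q t))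
    (hqdyn : ∀ t, deriv q t = Matrix.toEuclideanLin (M (q t))⁻¹ (p t))
    (hpdyn : ∀ t, deriv p t
        = -gradient (fun q' => H q' (p t)) (q t)
          - Matrix.toEuclideanLin (𝒟 (q t) (p t)) (Matrix.toEuclideanLin (M (q t))⁻¹ (p t))
          + u t)
    (hxcdyn : ∀ t, deriv xc t
        = -(Matrix.toEuclideanLin Rc)
            (Matrix.toEuclideanLin Kc (xc t) + gradient (fun xc' => Φc (q t) xc') (xc t))) :
    ∀ t, deriv (fun s => Hd (q s) (p s) (xc s)) t
          = -⟪deriv q t, Matrix.toEuclideanLin (𝒟 (q t) (p t)) (deriv q t)⟫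
            - ⟪gradient (fun xc' => Hd (q t) (p t) xc') (xc t),
                Matrix.toEuclideanLin Rc (gradient (fun xc' => Hd (q t) (p t) xc') (xc t))⟫
      ∧ deriv (fun s => Hd (q s) (p s) (xc s)) t ≤ 0 := by
  intro t
  set A := fun x => toEuclideanCLM (n := Fin n) (𝕜 := ℝ) (M x)⁻¹ with hA_def
  set T := toEuclideanCLM (n := Fin n) (𝕜 := ℝ) Kc with hT_def
  set ψ : EuclideanSpace ℝ (Fin n) → ℝ := fun z =>
    ∑ i, αc i / βc i * Real.log (Real.cosh (βc i * (z i - qs i))) with hψ_def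
  have hA : Differentiable ℝ A :=
    differentiable_toEuclideanCLM_inv (fun i j => (hM i j).differentiable one_ne_zero)
      fun x => (hMpd x).isUnit
  have hAsymm : (A (q t) : EuclideanSpace ℝ (Fin n) →ₗ[ℝ] EuclideanSpace ℝ (Fin n)).IsSymmetric :=
    (hMpd (q t)).isHermitian.inv.isSymmetric_toEuclideanCLM
  have hTsymm : (T : EuclideanSpace ℝ (Fin n) →ₗ[ℝ] EuclideanSpace ℝ (Fin n)).IsSymmetric :=
    hKc.isHermitian.isSymmetric_toEuclideanCLM
  have hψ : Differentiable ℝ ψ := by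
    have hcosh (i : Fin n) (z : EuclideanSpace ℝ (Fin n)) :
        Real.cosh (βc i * (z i - qs i)) ≠ 0 := (Real.cosh_pos _).ne'
    refine Differentiable.fun_sum fun i _ => Differentiable.const_mul ?_ _
    refine Differentiable.log ?_ (hcosh i)
    fun_prop
  have hΦ (x y : EuclideanSpace ℝ (Fin n)) : Φc x y = ψ (x + y) := by
    rw [hΦc, hψ_def]
    refine Finset.sum_congr rfl fun i _ => ?_
    rw [PiLp.add_apply, add_sub_right_comm]
  have hAlin (x y : EuclideanSpace ℝ (Fin n)) : toEuclideanLin (M x)⁻¹ y = A x y := rfl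
  have hTlin (y : EuclideanSpace ℝ (Fin n)) : toEuclideanLin Kc y = T y := rfl
  have hΦx (a x : EuclideanSpace ℝ (Fin n)) :
      gradient (fun y => Φc y a) x = gradient ψ (x + a) := by
    simp only [hΦ, gradient_comp_add_right]
  have hΦy (a x : EuclideanSpace ℝ (Fin n)) :
      gradient (fun y => Φc a y) x = gradient ψ (a + x) := by
    simp only [hΦ, add_comm a, gradient_comp_add_right]
  have hquad := hasGradientAt_half_inner_self hTsymm (xc t)
  have hgradHd : gradient (fun y => Hd (q t) (p t) y) (xc t)
      = gradient ψ (q t + xc t) + T (xc t) := by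
    have h₁ : DifferentiableAt ℝ (fun y => ψ (q t + y)) (xc t) := by fun_prop
    have h₂ : gradient (fun y => ψ (q t + y)) (xc t) = gradient ψ (q t + xc t) := by
      simpa only [hΦ] using hΦy (q t) (xc t)
    simp only [hHd, hΦ, hAlin, hTlin]
    rw [gradient_fun_add (by fun_prop) hquad.differentiableAt, gradient_fun_add h₁ (by fun_prop),
      hquad.gradient, h₂, gradient_fun_const, add_zero]
  have hgradH : gradient (fun y => H y (p t)) (q t)
      = gradient (fun y => 1 / 2 * ⟪p t, A y (p t)⟫) (q t) + gradient V (q t) := by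
    simp only [hH, hAlin]
    exact gradient_fun_add (((differentiableAt_const (p t)).inner ℝ
      ((hA (q t)).clm_apply (differentiableAt_const (p t)))).const_mul (1 / 2 : ℝ))
      (hV.differentiable one_ne_zero _)
  have hq' := (hq t).hasDerivAt
  have hp' := (hp t).hasDerivAt
  have hx' := (hxc t).hasDerivAt
  have hderiv : HasDerivAt (fun s => Hd (q s) (p s) (xc s))
      (⟪gradient ψ (q t + xc t), deriv q t + deriv xc t⟫
        + (⟪gradient (fun y => 1 / 2 * ⟪p t, A y (p t)⟫) (q t), deriv q t⟫
          + ⟪A (q t) (p t), deriv p t⟫) + ⟪T (xc t), deriv xc t⟫) t := by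
    simp only [hHd, hΦ, hAlin, hTlin]
    have h₁ := DifferentiableAt.hasDerivAt_comp_gradient (γ := fun s => q s + xc s)
      (hψ (q t + xc t)) (hq'.add hx')
    have h₂ := hasDerivAt_half_inner_apply_self (hA (q t)) hAsymm hq' hp'
    have h₃ := hquad.differentiableAt.hasDerivAt_comp_gradient hx'
    rw [hquad.gradient] at h₃
    exact (h₁.add h₂).add h₃
  have hmain : deriv (fun s => Hd (q s) (p s) (xc s)) t
      = -⟪deriv q t, toEuclideanLin (𝒟 (q t) (p t)) (deriv q t)⟫
        - ⟪gradient (fun y => Hd (q t) (p t) y) (xc t),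
            toEuclideanLin Rc (gradient (fun y => Hd (q t) (p t) y) (xc t))⟫ := by
    have hx : deriv xc t = -toEuclideanLin Rc (gradient ψ (q t + xc t) + T (xc t)) := by
      rw [hxcdyn, hΦy, hTlin, add_comm (T (xc t))]
    have hpd := hpdyn t
    rw [← hqdyn t, hgradH, hu, hΦx] at hpd
    rw [hderiv.deriv, hgradHd, ← hAlin, ← hqdyn t, hpd]
    have hR : ⟪gradient ψ (q t + xc t), deriv xc t⟫ + ⟪T (xc t), deriv xc t⟫
        = -⟪gradient ψ (q t + xc t) + T (xc t),
          toEuclideanLin Rc (gradient ψ (q t + xc t) + T (xc t))⟫ := by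
      rw [← inner_add_left, hx, inner_neg_right]
    simp only [inner_add_right, inner_sub_right, inner_neg_right]
    rw [real_inner_comm (deriv q t) (gradient ψ (q t + xc t)),
      real_inner_comm (deriv q t) (gradient (fun y => 1 / 2 * ⟪p t, A y (p t)⟫) (q t))]
    linarith
  refine ⟨hmain, ?_⟩
  rw [hmain]
  have h₁ := (h𝒟 (q t) (p t)).inner_toEuclideanLin_nonneg (deriv q t)
  have h₂ := hRc.posSemidef.inner_toEuclideanLin_nonneg
    (gradient (fun y => Hd (q t) (p t) y) (xc t))
  linarith
end

section
/- Let R₁, R₂, C, m₁, m₂, a₀, a₁, a₂, a₃, k be strictly positive real constants. Define S : ℝ⁵ → ℝ by S(x) = x₁²/(2C) + (k/2)(x₂ − x₃)² + x₄²/(2m₁) + x₅²/(2m₂), and f : ℝ⁵ → ℝ⁵ by f₁(x) = −(1/R₁ + 1/R₂)(x₁/C) + x₄/(a₀ m₁ R₂), f₂(x) = x₄/m₁, f₃(x) = x₅/m₂, f₄(x) = −k(x₂ − x₃) + (1/(a₀R₂))(x₁/C − x₄/(a₀ m₁)), f₅(x) = k(x₂ − x₃) − (a₁/m₂)x₅ −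 a₂ tanh(a₃ x₅). Then for every x ∈ ℝ⁵: ⟨∇S(x), f(x)⟩ = −x₁²/(C²R₁) − (1/R₂)(x₁/C − x₄/(a₀ m₁))² − (a₁/m₂²)x₅² − (a₂/m₂) x₅ tanh(a₃ x₅), and in particular ⟨∇S(x), f(x)⟩ ≤ 0. -/
open RealInnerProductSpace

theorem Real.mul_tanh_mul_nonneg {a : ℝ} (ha : 0 ≤ a) (t : ℝ) : 0 ≤ t * Real.tanh (a * t) := by
  rw [Real.tanh_eq_sinh_div_cosh, ← mul_div_assoc]
  refine div_nonneg ?_ (Real.cosh_pos _).le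
  rcases le_total 0 t with ht | ht
  · exact mul_nonneg ht (Real.sinh_nonneg_iff.2 (mul_nonneg ha ht))
  · exact mul_nonneg_of_nonpos_of_nonpos ht
      (Real.sinh_nonpos_iff.2 (mul_nonpos_of_nonneg_of_nonpos ha ht))

/-- Cyclo-passivity of the electromechanical coupling device: with total energy `S` and
drift vector field `f`, one has
`⟨∇S(x), f(x)⟩ = −x₁²/(C²R₁) − (1/R₂)(x₁/C − x₄/(a₀m₁))² − (a₁/m₂²)x₅² − (a₂/m₂)x₅tanh(a₃x₅) ≤ 0`. -/
theorem stmt_18 (R₁ R₂ C m₁ m₂ a₀ a₁ a₂ a₃ k : ℝ)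
    (hR₁ : 0 < R₁) (hR₂ : 0 < R₂) (hC : 0 < C) (hm₁ : 0 < m₁) (hm₂ : 0 < m₂)
    (ha₀ : 0 < a₀) (ha₁ : 0 < a₁) (ha₂ : 0 < a₂) (ha₃ : 0 < a₃) (hk : 0 < k)
    (S : EuclideanSpace ℝ (Fin 5) → ℝ)
    (hS : ∀ x, S x = x 0 ^ 2 / (2 * C) + k / 2 * (x 1 - x 2) ^ 2
        + x 3 ^ 2 / (2 * m₁) + x 4 ^ 2 / (2 * m₂))
    (f : EuclideanSpace ℝ (Fin 5) → EuclideanSpace ℝ (Fin 5))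
    (hf : ∀ x, f x = (EuclideanSpace.equiv (Fin 5) ℝ).symm
      ![-(1 / R₁ + 1 / R₂) * (x 0 / C) + x 3 / (a₀ * m₁ * R₂),
        x 3 / m₁,
        x 4 / m₂,
        -k * (x 1 - x 2) + 1 / (a₀ * R₂) * (x 0 / C - x 3 / (a₀ * m₁)),
        k * (x 1 - x 2) - a₁ / m₂ * x 4 - a₂ * Real.tanh (a₃ * x 4)]) :
    ∀ x : EuclideanSpace ℝ (Fin 5),
      ⟪gradient S x, f x⟫
          = -(x 0 ^ 2 / (C ^ 2 * R₁)) - 1 / R₂ * (x 0 / C - x 3 / (a₀ * m₁)) ^ 2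
            - a₁ / m₂ ^ 2 * x 4 ^ 2 - a₂ / m₂ * (x 4 * Real.tanh (a₃ * x 4))
      ∧ ⟪gradient S x, f x⟫ ≤ 0 := by
  intro x
  have hproj (i : Fin 5) : HasFDerivAt (fun y : EuclideanSpace ℝ (Fin 5) => y i)
      (EuclideanSpace.proj i : EuclideanSpace ℝ (Fin 5) →L[ℝ] ℝ) x :=
    (EuclideanSpace.proj i : EuclideanSpace ℝ (Fin 5) →L[ℝ] ℝ).hasFDerivAt
  have hderiv := (((((hproj 0).pow 2).mul_const (2 * C)⁻¹).add
    ((((hproj 1).sub (hproj 2)).pow 2).const_mul (k / 2))).add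
    (((hproj 3).pow 2).mul_const (2 * m₁)⁻¹)).add (((hproj 4).pow 2).mul_const (2 * m₂)⁻¹)
  have hSderiv := hderiv.congr_of_eventuallyEq (f₁ := S) (.of_forall fun y => by
    simp [hS, div_eq_mul_inv])
  have heq : ⟪gradient S x, f x⟫
      = -(x 0 ^ 2 / (C ^ 2 * R₁)) - 1 / R₂ * (x 0 / C - x 3 / (a₀ * m₁)) ^ 2
        - a₁ / m₂ ^ 2 * x 4 ^ 2 - a₂ / m₂ * (x 4 * Real.tanh (a₃ * x 4)) := by
    rw [gradient, InnerProductSpace.toDual_symm_apply, hSderiv.fderiv, hf]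
    simp
    field_simp
    ring
  refine ⟨heq, heq.le.trans ?_⟩
  have h₀ : 0 ≤ x 0 ^ 2 / (C ^ 2 * R₁) := by positivity
  have h₁ : 0 ≤ 1 / R₂ * (x 0 / C - x 3 / (a₀ * m₁)) ^ 2 := by positivity
  have h₂ : 0 ≤ a₁ / m₂ ^ 2 * x 4 ^ 2 := by positivity
  have h₃ : 0 ≤ a₂ / m₂ * (x 4 * Real.tanh (a₃ * x 4)) :=
    mul_nonneg (by positivity) (Real.mul_tanh_mul_nonneg ha₃.le _)
  linarith
end
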